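/- Let q be a prime, a ≥ 2 and b ≥ 1 integers. Let D₀ be the uniform distribution on (ZMod q)^{a×b} and D₃ the probability distribution of (1,u)·vᵀ with u uniform on (ZMod q)^{a−1} and v uniform on (ZMod q)^b (independently), where (1,u) is the vector in (ZMod q)^a with first coordinate 1 and remaining coordinates u. Then the statistical distance between D₀ and the uniform distribution on rank-min(a,b) matrices is at most min(a,b)·q^{−(|a−b|+1)}, and consequently, combining with the fact that the statistical distance between the uniform distribution on rank-1 matrices and D₃ is at most 1/q + (q^{−a}+q^{−b}), any distinguisher's statistical advantage between D₃ and the uniform distribution on rank-1 matrices of (ZMod q)^{a×b} is at most 1/q + q^{−a} + q^{−b} + q^{−min(a,b)}. -/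

import Mathlib

open scoped Classical

/-- Statistical (total variation) distance between two mass functions on a finite type. -/
noncomputable def statDist {α : Type*} [Fintype α] (P Q : α → ℝ) : ℝ :=
  (1 / 2) * ∑ x, |P x - Q x|

/-- The uniform probability mass function on a subset of a finite type. -/
noncomputable def unifOn {α : Type*} [Fintype α] (s : Set α) : α → ℝ :=
  fun x => if x ∈ s then 1 / (Nat.card s : ℝ) else 0

theorem aux_prod (k : ℕ) (f : Fin k → ℝ) (h0 : ∀ i, 0 ≤ f i) (h1 : ∀ i, f i ≤ 1) :
    1 - ∑ i, f i ≤ ∏ i, (1 - f i) ∧ 0 ≤ ∏ i, (1 - f i) ∧ ∏ i, (1 - f i) ≤ 1 := by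
  induction k with
  | zero => simp
  | succ k ih =>
    obtain ⟨a, b, c⟩ := ih (fun i => f i.succ) (fun i => h0 _) (fun i => h1 _)
    rw [Fin.sum_univ_succ, Fin.prod_univ_succ]
    have := h0 0
    have := h1 0
    refine ⟨by nlinarith, by nlinarith, by nlinarith⟩

theorem aux_statDist {α : Type*} [Fintype α] (S : Set α) (N : ℝ)
    (hN : (Fintype.card α : ℝ) = N) (hS : 0 < Nat.card S) :
    statDist (fun _ : α => 1 / N) (unifOn S) = 1 - (Nat.card S : ℝ) / N := by
  unfold statDist unifOn
  have hc : Nat.card S = (Finset.univ.filter (fun x => x ∈ S)).card := by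
    rw [Nat.card_eq_fintype_card, Fintype.card_subtype]
  have hle : Nat.card S ≤ Fintype.card α := by
    rw [hc]; exact Finset.card_le_univ _
  have hle' : (Nat.card S : ℝ) ≤ N := by rw [← hN]; exact_mod_cast hle
  have hs : (0 : ℝ) < Nat.card S := by exact_mod_cast hS
  have hNp : 0 < N := lt_of_lt_of_le hs hle'
  have key : ∀ x : α, |1 / N - (if x ∈ S then 1 / (Nat.card S : ℝ) else 0)|
      = 1 / N + (if x ∈ S then 1 / (Nat.card S : ℝ) - 2 / N else 0) := by
    intro x
    split_ifs
    · have : 1 / N ≤ 1 / (Nat.card S : ℝ) := one_div_le_one_div_of_le hs hle'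
      rw [abs_of_nonpos (by linarith)]; ring
    · rw [sub_zero, add_zero, abs_of_pos (by positivity)]
  rw [Finset.sum_congr rfl (fun x _ => key x), Finset.sum_add_distrib, ← Finset.sum_filter,
    Finset.sum_const, Finset.sum_const, ← hc, Finset.card_univ, nsmul_eq_mul, nsmul_eq_mul, hN]
  field_simp
  ring

theorem aux_full (q : ℕ) [Fact q.Prime] (k m : ℕ) (hkm : k ≤ m) :
    0 < Nat.card {M : Matrix (Fin k) (Fin m) (ZMod q) | M.rank = k} ∧
    1 - (Nat.card {M : Matrix (Fin k) (Fin m) (ZMod q) | M.rank = k} : ℝ) / (q : ℝ) ^ (k * m)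
      ≤ (k : ℝ) / (q : ℝ) ^ (m - k + 1) := by
  have hq : 1 < q := (Fact.out : q.Prime).one_lt
  have hq0 : (0 : ℝ) < q := by exact_mod_cast hq.le
  have hcard : Nat.card {M : Matrix (Fin k) (Fin m) (ZMod q) | M.rank = k}
      = ∏ i : Fin k, (q ^ m - q ^ i.val) := by
    have h := card_linearIndependent (K := ZMod q) (V := Fin m → ZMod q) (k := k) (by simpa using hkm)
    simp only [ZMod.card, Module.finrank_fintype_fun_eq_card, Fintype.card_fin] at h
    rw [← h]
    apply Nat.card_congr
    refine Equiv.subtypeEquivRight (fun M => ?_)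
    have h1 := linearIndependent_iff_card_eq_finrank_span (R := ZMod q) (b := M.row)
    rw [Set.finrank, ← Matrix.rank_eq_finrank_span_row, Fintype.card_fin] at h1
    exact eq_comm.trans h1.symm
  have hlt : ∀ i : Fin k, q ^ i.val < q ^ m := fun i =>
    Nat.pow_lt_pow_right hq (lt_of_lt_of_le i.2 hkm)
  constructor
  · rw [hcard]
    exact Finset.prod_pos (fun i _ => Nat.sub_pos_of_lt (hlt i))
  · have hr : (Nat.card {M : Matrix (Fin k) (Fin m) (ZMod q) | M.rank = k} : ℝ) / (q : ℝ) ^ (k * m)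
        = ∏ i : Fin k, (1 - (q : ℝ) ^ i.val / (q : ℝ) ^ m) := by
      have : (q : ℝ) ^ (k * m) = ∏ i : Fin k, (q : ℝ) ^ m := by
        simp [← pow_mul, mul_comm]
      rw [hcard, this, Nat.cast_prod, ← Finset.prod_div_distrib]
      refine Finset.prod_congr rfl (fun i _ => ?_)
      rw [Nat.cast_sub (hlt i).le]
      push_cast
      field_simp
    rw [hr]
    have hb := (aux_prod k (fun i => (q : ℝ) ^ i.val / (q : ℝ) ^ m) (fun i => by positivity)
      (fun i => by
        rw [div_le_one (by positivity)]
        exact_mod_cast (hlt i).le)).1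
    have hs : ∑ i : Fin k, (q : ℝ) ^ i.val / (q : ℝ) ^ m ≤ ∑ i : Fin k, 1 / (q : ℝ) ^ (m - k + 1) := by
      refine Finset.sum_le_sum (fun i _ => ?_)
      rw [div_le_div_iff₀ (by positivity) (by positivity), one_mul, ← pow_add]
      refine pow_le_pow_right₀ (by exact_mod_cast hq.le) ?_
      have := i.2
      omega
    have : ∑ i : Fin k, 1 / (q : ℝ) ^ (m - k + 1) = (k : ℝ) / (q : ℝ) ^ (m - k + 1) := by
      simp [div_eq_mul_inv]
    linarith

theorem aux_part1 (q : ℕ) [Fact q.Prime] (a b : ℕ) :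
    statDist
        (fun _ : Matrix (Fin a) (Fin b) (ZMod q) => 1 / (q : ℝ) ^ (a * b))
        (unifOn {M : Matrix (Fin a) (Fin b) (ZMod q) | M.rank = min a b})
      ≤ ((min a b : ℕ) : ℝ) / (q : ℝ) ^ ((max a b - min a b) + 1) := by
  have hN : (Fintype.card (Matrix (Fin a) (Fin b) (ZMod q)) : ℝ) = (q : ℝ) ^ (a * b) := by
    have : Fintype.card (Matrix (Fin a) (Fin b) (ZMod q))
        = Fintype.card (Fin a → Fin b → ZMod q) := Fintype.card_congr (Equiv.refl _)
    rw [this]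
    simp [ZMod.card, ← pow_mul, mul_comm]
  rcases le_total a b with h | h
  · obtain ⟨h1, h2⟩ := aux_full q a b h
    simp only [min_eq_left h, max_eq_right h]
    rw [aux_statDist _ _ hN h1]
    exact h2
  · obtain ⟨h1, h2⟩ := aux_full q b a h
    simp only [min_eq_right h, max_eq_left h]
    have he : Nat.card {M : Matrix (Fin a) (Fin b) (ZMod q) | M.rank = b}
        = Nat.card {M : Matrix (Fin b) (Fin a) (ZMod q) | M.rank = b} := by
      apply Nat.card_congr
      refine Equiv.subtypeEquiv ⟨Matrix.transpose, Matrix.transpose, fun _ => rfl, fun _ => rfl⟩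
        (fun M => ?_)
      change M.rank = b ↔ M.transpose.rank = b
      rw [Matrix.rank_transpose]
    rw [← he] at h1 h2
    rw [aux_statDist _ _ hN h1, mul_comm a b]
    exact h2

theorem aux_rank_one {q : ℕ} [Fact q.Prime] {a b : ℕ} (M : Matrix (Fin a) (Fin b) (ZMod q)) :
    M.rank = 1 ↔ ∃ u v, u ≠ 0 ∧ v ≠ 0 ∧ M = Matrix.vecMulVec u v := by
  constructor
  · intro h
    have h' := h
    rw [Matrix.rank_eq_finrank_span_row, finrank_eq_one_iff'] at h
    obtain ⟨⟨v, hv⟩, hv0, hall⟩ := h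
    have : ∀ i, ∃ c : ZMod q, c • v = M i := by
      intro i
      obtain ⟨c, hc⟩ := hall ⟨M i, Submodule.subset_span ⟨i, rfl⟩⟩
      exact ⟨c, congrArg Subtype.val hc⟩
    choose u hu using this
    have hM : M = Matrix.vecMulVec u v := by
      ext i j
      rw [← hu i]; rfl
    refine ⟨u, v, ?_, ?_, hM⟩
    · rintro rfl
      rw [hM, Matrix.zero_vecMulVec, Matrix.rank_zero] at h'
      omega
    · rintro rfl
      exact hv0 rfl
  · rintro ⟨u, v, hu, hv, rfl⟩
    apply le_antisymm (Matrix.rank_vecMulVec_le u v)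
    rw [Nat.one_le_iff_ne_zero]
    intro h0
    rw [Matrix.rank_eq_finrank_span_row, Submodule.finrank_eq_zero, Submodule.span_eq_bot] at h0
    obtain ⟨i, hi⟩ := Function.ne_iff.1 hu
    obtain ⟨j, hj⟩ := Function.ne_iff.1 hv
    have := congrFun (h0 _ ⟨i, rfl⟩) j
    exact mul_ne_zero hi hj this

theorem aux_Z {q : ℕ} [Fact q.Prime] {n b : ℕ} :
    q * (Finset.univ.filter (fun M : Matrix (Fin (n+1)) (Fin b) (ZMod q) =>
        M.rank = 1 ∧ M 0 = 0)).card
      ≤ (Finset.univ.filter (fun M : Matrix (Fin (n+1)) (Fin b) (ZMod q) => M.rank = 1)).card := by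
  have hex : ∀ M : Matrix (Fin (n+1)) (Fin b) (ZMod q), ∃ p : (Fin (n+1) → ZMod q) × (Fin b → ZMod q),
      (M.rank = 1 → p.1 ≠ 0 ∧ p.2 ≠ 0 ∧ M = Matrix.vecMulVec p.1 p.2) := by
    intro M
    by_cases h : M.rank = 1
    · obtain ⟨u, v, h1⟩ := (aux_rank_one M).1 h
      exact ⟨(u, v), fun _ => h1⟩
    · exact ⟨(0, 0), fun h' => absurd h' h⟩
  choose p hp using hex
  have hz : ∀ M, M.rank = 1 → M 0 = 0 → (p M).1 0 = 0 := by
    intro M h1 h2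
    obtain ⟨hu, hv, hM⟩ := hp M h1
    obtain ⟨j, hj⟩ := Function.ne_iff.1 hv
    have : (p M).1 0 * (p M).2 j = 0 := by
      have := congrFun h2 j
      rw [hM] at this
      exact this
    rcases mul_eq_zero.1 this with h | h
    · exact h
    · exact absurd h hj
  have hq : q = (Finset.univ : Finset (ZMod q)).card := by rw [Finset.card_univ, ZMod.card]
  refine le_of_eq_of_le (congrArg (fun t => t * _) hq) ?_
  rw [← Finset.card_product]
  refine Finset.card_le_card_of_injOn
    (fun x => Matrix.vecMulVec (Function.update (p x.2).1 0 x.1) (p x.2).2) ?_ ?_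
  · rintro ⟨c, M⟩ hx
    simp only [Finset.coe_product, Set.mem_prod, Finset.mem_coe, Finset.mem_filter,
      Finset.mem_univ, true_and] at hx ⊢
    obtain ⟨hu, hv, hM⟩ := hp M hx.1
    rw [aux_rank_one]
    refine ⟨_, _, ?_, hv, rfl⟩
    obtain ⟨i, hi⟩ := Function.ne_iff.1 hu
    have hi0 : i ≠ 0 := by
      rintro rfl
      exact hi (hz M hx.1 hx.2)
    intro h
    apply hi
    have := congrFun h i
    rwa [Function.update_of_ne hi0] at this
  · rintro ⟨c, M⟩ hx ⟨c', M'⟩ hx' heq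
    simp only [Finset.coe_product, Set.mem_prod, Finset.mem_coe, Finset.mem_filter,
      Finset.mem_univ, true_and] at hx hx' heq
    obtain ⟨hu, hv, hM⟩ := hp M hx.1
    obtain ⟨hu', hv', hM'⟩ := hp M' hx'.1
    have hMM : M = M' := by
      ext i j
      by_cases hi : i = 0
      · subst hi
        rw [hx.2, hx'.2]
      · have := congrFun (congrFun heq i) j
        simp only [Matrix.vecMulVec_apply, Function.update_of_ne hi] at this
        rw [hM, hM']
        exact this
    subst hMM
    obtain ⟨j, hj⟩ := Function.ne_iff.1 hv
    have := congrFun (congrFun heq 0) j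
    simp only [Matrix.vecMulVec_apply, Function.update_self] at this
    rw [mul_right_cancel₀ hj this]

theorem aux_sumT {q : ℕ} [Fact q.Prime] {n b : ℕ}
    (f : Matrix (Fin (n+1)) (Fin b) (ZMod q) → ℝ) :
    ∑ p : (Fin n → ZMod q) × (Fin b → ZMod q), f (Matrix.vecMulVec (Fin.cons 1 p.1) p.2)
      = (q : ℝ) ^ n * f 0 +
        ∑ M ∈ Finset.univ.filter (fun M : Matrix (Fin (n+1)) (Fin b) (ZMod q) =>
          M.rank = 1 ∧ M 0 ≠ 0), f M := by
  rw [← Finset.sum_filter_add_sum_filter_not Finset.univ (fun p => p.2 = 0)]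
  congr 1
  · have : Finset.univ.filter (fun p : (Fin n → ZMod q) × (Fin b → ZMod q) => p.2 = 0)
        = Finset.univ ×ˢ {0} := by
      ext p; rw [Finset.mem_product]; simp
    rw [this, Finset.sum_product]
    have h0 : ∀ u : Fin (n+1) → ZMod q, Matrix.vecMulVec u (0 : Fin b → ZMod q) = 0 := by
      intro u; ext i j; simp [Matrix.vecMulVec_apply]
    simp [h0, ZMod.card]
  · refine Finset.sum_bij (fun p _ => Matrix.vecMulVec (Fin.cons 1 p.1) p.2) ?_ ?_ ?_ ?_
    · rintro ⟨u, v⟩ h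
      simp only [Finset.mem_filter, Finset.mem_univ, true_and] at h ⊢
      refine ⟨(aux_rank_one _).2 ⟨_, _, ?_, h, rfl⟩, ?_⟩
      · intro h
        have := congrFun h 0
        simp at this
      · intro h0
        apply h
        ext j
        have := congrFun h0 j
        simpa [Matrix.vecMulVec_apply] using this
    · rintro ⟨u, v⟩ h ⟨u', v'⟩ h' heq
      simp only [Finset.mem_filter, Finset.mem_univ, true_and] at h h'
      have hv : v = v' := by
        ext j
        have := congrFun (congrFun heq 0) j
        simpa [Matrix.vecMulVec_apply] using this
      subst hv
      obtain ⟨j, hj⟩ := Function.ne_iff.1 h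
      congr 1
      ext i
      have := congrFun (congrFun heq i.succ) j
      simp only [Matrix.vecMulVec_apply, Fin.cons_succ] at this
      exact mul_right_cancel₀ hj this
    · intro M hM
      simp only [Finset.mem_filter, Finset.mem_univ, true_and] at hM
      obtain ⟨u, v, hu, hv, rfl⟩ := (aux_rank_one M).1 hM.1
      have hu0 : u 0 ≠ 0 := by
        intro h
        apply hM.2
        ext j
        simp [Matrix.vecMulVec_apply, h]
      refine ⟨(fun i => u i.succ / u 0, u 0 • v), ?_, ?_⟩
      · simp [hu0, hv]
      · ext i j
        refine Fin.cases ?_ (fun i => ?_) i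
        · simp [Matrix.vecMulVec_apply]
        · simp only [Matrix.vecMulVec_apply, Fin.cons_succ, Pi.smul_apply, smul_eq_mul]
          field_simp
    · intros; rfl

theorem aux_arith (qi B N T Z R f0 FT FZ : ℝ) (hN : 0 < N) (hR : 0 < R)
    (hT : T = N * (1 - B)) (hRT : R = T + Z) (hZ : Z ≤ qi * R)
    (h0 : 0 ≤ f0) (h0' : f0 ≤ 1) (hFT : 0 ≤ FT) (hFT' : FT ≤ T) (hFZ : 0 ≤ FZ) (hFZ' : FZ ≤ Z)
    (hB : 0 ≤ B) (hq : 0 ≤ qi) :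
    |(B * f0 + FT / N) - (FT + FZ) / R| ≤ qi + B := by
  have hT0 : 0 ≤ T := hFT.trans hFT'
  have hTN : T / N = 1 - B := by rw [hT]; field_simp
  have hTR : T / R = 1 - Z / R := by rw [eq_sub_iff_add_eq, ← add_div, ← hRT, div_self hR.ne']
  have hZR : Z / R ≤ qi := by rw [div_le_iff₀ hR]; exact hZ
  have hZR0 : 0 ≤ Z / R := div_nonneg (hFZ.trans hFZ') hR.le
  have hFZR : FZ / R ≤ Z / R := by gcongr
  have hFZR0 : 0 ≤ FZ / R := by positivity
  have e : (B * f0 + FT / N) - (FT + FZ) / R = B * f0 + FT * (1 / N - 1 / R) - FZ / R := by ring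
  have e2 : T * (1 / N - 1 / R) = Z / R - B := by
    have : T * (1 / N - 1 / R) = T / N - T / R := by ring
    rw [this, hTN, hTR]; ring
  have hBf : B * f0 ≤ B := by nlinarith
  have hBf0 : 0 ≤ B * f0 := by positivity
  rw [e, abs_le]
  rcases le_total 0 (1 / N - 1 / R) with h | h
  · have := mul_le_mul_of_nonneg_right hFT' h
    have := mul_nonneg hFT h
    constructor <;> linarith
  · have := mul_le_mul_of_nonpos_right hFT' h
    have := mul_nonpos_of_nonneg_of_nonpos hFT h
    constructor <;> linarith

theorem aux_part2 (q : ℕ) [Fact q.Prime] (n b : ℕ) (hb : 1 ≤ b)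
    (f : Matrix (Fin (n+1)) (Fin b) (ZMod q) → ℝ) (hf0 : ∀ M, 0 ≤ f M) (hf1 : ∀ M, f M ≤ 1) :
      |(∑ M : Matrix (Fin (n + 1)) (Fin b) (ZMod q),
          ((Nat.card {p : (Fin n → ZMod q) × (Fin b → ZMod q) //
              Matrix.vecMulVec (Fin.cons 1 p.1) p.2 = M} : ℝ)
                / ((q : ℝ) ^ n * (q : ℝ) ^ b))
            * f M)
        - (∑ M : Matrix (Fin (n + 1)) (Fin b) (ZMod q),
            unifOn {M' : Matrix (Fin (n + 1)) (Fin b) (ZMod q) | M'.rank = 1} M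
              * f M)| ≤ 1 / (q : ℝ) + ((q : ℝ) ^ b)⁻¹ := by
  have hq : 1 < q := (Fact.out : q.Prime).one_lt
  have hq0 : (0 : ℝ) < q := by exact_mod_cast hq.le
  set TS := Finset.univ.filter (fun M : Matrix (Fin (n+1)) (Fin b) (ZMod q) =>
          M.rank = 1 ∧ M 0 ≠ 0) with hTS
  set ZS := Finset.univ.filter (fun M : Matrix (Fin (n+1)) (Fin b) (ZMod q) =>
          M.rank = 1 ∧ M 0 = 0) with hZS
  set RS := Finset.univ.filter (fun M : Matrix (Fin (n+1)) (Fin b) (ZMod q) =>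
          M.rank = 1) with hRS
  have hsplit : ∀ g : Matrix (Fin (n+1)) (Fin b) (ZMod q) → ℝ,
      ∑ M ∈ RS, g M = ∑ M ∈ TS, g M + ∑ M ∈ ZS, g M := by
    intro g
    rw [← Finset.sum_filter_add_sum_filter_not RS (fun M => M 0 ≠ 0)]
    simp only [hRS, hTS, hZS, Finset.filter_filter, not_not]
  have h1 : ∑ M : Matrix (Fin (n + 1)) (Fin b) (ZMod q),
          ((Nat.card {p : (Fin n → ZMod q) × (Fin b → ZMod q) //
              Matrix.vecMulVec (Fin.cons 1 p.1) p.2 = M} : ℝ)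
                / ((q : ℝ) ^ n * (q : ℝ) ^ b)) * f M
      = ((q : ℝ) ^ b)⁻¹ * f 0 + (∑ M ∈ TS, f M) / ((q : ℝ) ^ n * (q : ℝ) ^ b) := by
    have e1 : ((q : ℝ) ^ b)⁻¹ * f 0 + (∑ M ∈ TS, f M) / ((q : ℝ) ^ n * (q : ℝ) ^ b)
        = ((q : ℝ) ^ n * f 0 + ∑ M ∈ TS, f M) / ((q : ℝ) ^ n * (q : ℝ) ^ b) := by
      field_simp
    rw [e1, hTS, ← aux_sumT, ← Finset.sum_fiberwise Finset.univ
      (fun p : (Fin n → ZMod q) × (Fin b → ZMod q) =>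
        (Matrix.vecMulVec (Fin.cons 1 p.1) p.2 : Matrix (Fin (n+1)) (Fin b) (ZMod q))),
      Finset.sum_div]
    refine Finset.sum_congr rfl (fun M _ => ?_)
    rw [Finset.sum_congr rfl (g := fun _ => f M) (fun p hp => by
      rw [(Finset.mem_filter.1 hp).2]), Finset.sum_const, nsmul_eq_mul,
      Nat.card_eq_fintype_card, Fintype.card_subtype]
    ring
  have hRc : (Nat.card {M' : Matrix (Fin (n + 1)) (Fin b) (ZMod q) | M'.rank = 1}) = RS.card := by
    rw [Nat.card_eq_fintype_card, Fintype.card_subtype]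
    rfl
  have h2 : ∑ M : Matrix (Fin (n + 1)) (Fin b) (ZMod q),
            unifOn {M' : Matrix (Fin (n + 1)) (Fin b) (ZMod q) | M'.rank = 1} M * f M
      = (∑ M ∈ TS, f M + ∑ M ∈ ZS, f M) / (RS.card : ℝ) := by
    rw [← hsplit, Finset.sum_div, hRS, Finset.sum_filter]
    refine Finset.sum_congr rfl (fun M _ => ?_)
    unfold unifOn
    rw [hRc]
    simp only [Set.mem_setOf_eq]
    split_ifs
    · rw [← hRS]; ring
    · simp
  have hTc : (TS.card : ℝ) = ((q : ℝ) ^ n * (q : ℝ) ^ b) * (1 - ((q : ℝ) ^ b)⁻¹) := by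
    have := aux_sumT (q := q) (n := n) (b := b) (fun _ => 1)
    simp only [Finset.sum_const, nsmul_eq_mul, mul_one, Finset.card_univ, Fintype.card_prod,
      Fintype.card_fun, ZMod.card, Fintype.card_fin, Nat.cast_mul, Nat.cast_pow] at this
    have h3 : (q : ℝ) ^ b ≠ 0 := by positivity
    rw [mul_sub, mul_assoc _ _ (_⁻¹), mul_inv_cancel₀ h3]
    linarith
  have hRTZ : (RS.card : ℝ) = TS.card + ZS.card := by
    have := hsplit (fun _ => 1)
    simpa using this
  have hTpos : (0 : ℝ) < TS.card := by
    rw [hTc]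
    have : ((q : ℝ) ^ b)⁻¹ < 1 := inv_lt_one_of_one_lt₀
      (one_lt_pow₀ (by exact_mod_cast hq) (by omega))
    have : 0 < 1 - ((q : ℝ) ^ b)⁻¹ := by linarith
    positivity
  have hZ : (ZS.card : ℝ) ≤ 1 / q * RS.card := by
    have : ((q * ZS.card : ℕ) : ℝ) ≤ RS.card := by exact_mod_cast aux_Z
    push_cast at this
    rw [one_div_mul_eq_div, le_div_iff₀ hq0]
    linarith
  have hle : ∀ s : Finset (Matrix (Fin (n+1)) (Fin b) (ZMod q)), ∑ M ∈ s, f M ≤ s.card := by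
    intro s
    calc ∑ M ∈ s, f M ≤ ∑ M ∈ s, (1 : ℝ) := Finset.sum_le_sum (fun M _ => hf1 M)
      _ = s.card := by simp
  rw [h1, h2]
  refine aux_arith (1 / q) _ _ TS.card ZS.card RS.card (f 0) _ _ (by positivity) ?_ hTc hRTZ hZ
    (hf0 0) (hf1 0) (Finset.sum_nonneg fun M _ => hf0 M) (hle _)
    (Finset.sum_nonneg fun M _ => hf0 M) (hle _) (by positivity) (by positivity)
  rw [hRTZ]
  positivity

theorem stmt11 (q : ℕ) [Fact q.Prime] (n b : ℕ) (hn : 1 ≤ n) (hb : 1 ≤ b) :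
    statDist
        (fun _ : Matrix (Fin (n + 1)) (Fin b) (ZMod q) => 1 / (q : ℝ) ^ ((n + 1) * b))
        (unifOn {M : Matrix (Fin (n + 1)) (Fin b) (ZMod q) | M.rank = min (n + 1) b})
      ≤ (min (n + 1) b : ℝ) / (q : ℝ) ^ ((max (n + 1) b - min (n + 1) b) + 1) ∧
    ∀ A : Matrix (Fin (n + 1)) (Fin b) (ZMod q) → Bool,
      |(∑ M : Matrix (Fin (n + 1)) (Fin b) (ZMod q),
          ((Nat.card {p : (Fin n → ZMod q) × (Fin b → ZMod q) //
              Matrix.vecMulVec (Fin.cons 1 p.1) p.2 = M} : ℝ)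
                / ((q : ℝ) ^ n * (q : ℝ) ^ b))
            * (if A M then 1 else 0))
        - (∑ M : Matrix (Fin (n + 1)) (Fin b) (ZMod q),
            unifOn {M' : Matrix (Fin (n + 1)) (Fin b) (ZMod q) | M'.rank = 1} M
              * (if A M then 1 else 0))|
      ≤ 1 / (q : ℝ) + ((q : ℝ) ^ (n + 1))⁻¹ + ((q : ℝ) ^ b)⁻¹
          + ((q : ℝ) ^ (min (n + 1) b))⁻¹ := by

  refine ⟨?_, fun A => ?_⟩
  · have h := aux_part1 q (n + 1) b
    push_cast at h
    exact h
  · have h := aux_part2 q n b hb (fun M => if A M then 1 else 0)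
      (fun M => by split_ifs <;> norm_num) (fun M => by split_ifs <;> norm_num)
    have h1 : 0 ≤ ((q : ℝ) ^ (n + 1))⁻¹ := by positivity
    have h2 : 0 ≤ ((q : ℝ) ^ (min (n + 1) b))⁻¹ := by positivity
    refine h.trans ?_
    linarith
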